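/- Berger's lemma (algebraic form): Let R be an Einstein algebraic curvature tensor with constant λ on a 4-dimensional real inner product space V. Then there exists an orthonormal basis (e_0, e_1, e_2, e_3) of V such that, writing R_{ijkl} = R(e_i,e_j,e_k,e_l) and K_{ij} = R_{ijij}: (1) K_{01} equals the maximum of the sectional curvature K over all 2-planes in V; (2) K_{03} equals the minimum of K over all 2-planes in V; (3) R_{ijik} = 0 whenever j ≠ k, for all indices 0 ≤ i,j,k ≤ 3; (4) |R_{0123} − R_{0231}| ≤ K_{01} − K_{02} and |R_{0231} − R_{0312}| ≤ K_{02} − K_{03}. -/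

import Mathlib

open scoped RealInnerProductSpace

section BergerAux

variable {V : Type*} [NormedAddCommGroup V] [InnerProductSpace ℝ V]

/-- The coefficients of a trigonometric quadratic form that is nowhere positive. -/
theorem nonpos_and_eq_zero_of_forall_circle {a b : ℝ}
    (h : ∀ C S : ℝ, C ^ 2 + S ^ 2 = 1 →
      a * (2 * C * S) ^ 2 + b * (2 * C * S) * (C ^ 2 - S ^ 2) ≤ 0) : a ≤ 0 ∧ b = 0 := by
  have key : ∀ θ : ℝ, a * Real.sin θ ^ 2 + b * Real.sin θ * Real.cos θ ≤ 0 := by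
    intro θ
    have h1 := h (Real.cos (θ / 2)) (Real.sin (θ / 2)) (Real.cos_sq_add_sin_sq _)
    have hs : Real.sin θ = 2 * Real.cos (θ / 2) * Real.sin (θ / 2) := by
      rw [← mul_div_cancel₀ θ (two_ne_zero' ℝ), mul_div_assoc, Real.sin_two_mul]
      ring_nf
    have hc : Real.cos θ = Real.cos (θ / 2) ^ 2 - Real.sin (θ / 2) ^ 2 := by
      rw [← mul_div_cancel₀ θ (two_ne_zero' ℝ), mul_div_assoc, Real.cos_two_mul']
      ring_nf
    rwa [hs, hc]
  have hquad : ∀ t : ℝ, a * t ^ 2 + b * t ≤ 0 := by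
    intro t
    have h1 := key (Real.arctan t)
    have hcos := Real.cos_arctan_pos t
    have hsin : Real.sin (Real.arctan t) = t * Real.cos (Real.arctan t) := by
      rw [Real.sin_arctan, Real.cos_arctan]; ring
    rw [hsin] at h1
    by_contra! h2
    nlinarith [mul_pos h2 (pow_pos hcos 2)]
  have ha : a ≤ 0 := by simpa using key (Real.pi / 2)
  refine ⟨ha, ?_⟩
  have h1 := hquad (b / (1 - a))
  have hpos : 0 < 1 - a := by linarith
  have h2 : a * (b / (1 - a)) ^ 2 + b * (b / (1 - a)) = (b / (1 - a)) ^ 2 := by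
    field_simp; ring
  have h3 : b / (1 - a) = 0 := by nlinarith
  simpa [hpos.ne'] using h3

/-- Quadrilinear forms with the symmetries of a curvature tensor, apart from the Bianchi identity. -/
structure HasCurvatureSymmetries (R : V →ₗ[ℝ] V →ₗ[ℝ] V →ₗ[ℝ] V →ₗ[ℝ] ℝ) : Prop where
  anti : ∀ x y z w : V, R x y z w = - R y x z w
  pair : ∀ x y z w : V, R x y z w = R z w x y

/-- The Einstein condition, tested on orthonormal frames given as families of four vectors. -/
def IsEinsteinOnFrames (R : V →ₗ[ℝ] V →ₗ[ℝ] V →ₗ[ℝ] V →ₗ[ℝ] ℝ) (lam : ℝ) : Prop :=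
  ∀ f : Fin 4 → V, Orthonormal ℝ f → ∀ i j : Fin 4,
    ∑ m, R (f i) (f m) (f j) (f m) = lam * ⟪f i, f j⟫

variable {R : V →ₗ[ℝ] V →ₗ[ℝ] V →ₗ[ℝ] V →ₗ[ℝ] ℝ} {lam : ℝ}

namespace HasCurvatureSymmetries

theorem anti' (hR : HasCurvatureSymmetries R) (x y z w : V) : R x y z w = - R x y w z := by
  rw [hR.pair, hR.anti, hR.pair w z]

theorem self_left (hR : HasCurvatureSymmetries R) (x z w : V) : R x x z w = 0 := by
  linarith [hR.anti x x z w]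

theorem self_right (hR : HasCurvatureSymmetries R) (x y z : V) : R x y z z = 0 := by
  linarith [hR.anti' x y z z]

theorem swap_swap (hR : HasCurvatureSymmetries R) (x y z w : V) : R x y z w = R y x w z := by
  rw [hR.anti, hR.anti', neg_neg]

end HasCurvatureSymmetries

/-- Orthonormality of four vectors, spelled out. -/
theorem orthonormal_four_iff {a b c d : V} :
    Orthonormal ℝ ![a, b, c, d] ↔
      (⟪a, a⟫ = 1 ∧ ⟪b, b⟫ = 1 ∧ ⟪c, c⟫ = 1 ∧ ⟪d, d⟫ = 1) ∧
      ⟪a, b⟫ = 0 ∧ ⟪a, c⟫ = 0 ∧ ⟪a, d⟫ = 0 ∧ ⟪b, c⟫ = 0 ∧ ⟪b, d⟫ = 0 ∧ ⟪c, d⟫ = 0 := by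
  simp [orthonormal_vecCons_iff, Fin.forall_fin_succ,
    pow_eq_one_iff_of_nonneg]
  tauto

/-- Simultaneous rotation in two orthogonal coordinate planes. -/
theorem orthonormal_rotate {a b c d : V} (h : Orthonormal ℝ ![a, b, c, d]) {C S : ℝ}
    (hCS : C ^ 2 + S ^ 2 = 1) :
    Orthonormal ℝ ![C • a + S • d, C • b + S • c, C • c - S • b, C • d - S • a] := by
  rw [orthonormal_four_iff] at h ⊢
  obtain ⟨⟨aa, bb, cc, dd⟩, ab, ac, ad, bc, bd, cd⟩ := h
  have ba := (real_inner_comm a b).trans ab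
  have ca := (real_inner_comm a c).trans ac
  have da := (real_inner_comm a d).trans ad
  have cb := (real_inner_comm b c).trans bc
  have db := (real_inner_comm b d).trans bd
  have dc := (real_inner_comm c d).trans cd
  simp only [inner_add_left, inner_add_right, inner_sub_left, inner_sub_right,
    real_inner_smul_left, real_inner_smul_right, aa, bb, cc, dd, ab, ac, ad, bc, bd, cd,
    ba, ca, da, cb, db, dc]
  refine ⟨⟨?_, ?_, ?_, ?_⟩, ?_, ?_, ?_, ?_, ?_, ?_⟩ <;> linarith

namespace IsEinsteinOnFrames

variable {a b c d : V}

/-- In an Einstein curvature tensor orthogonal planes have equal sectional curvature. -/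
theorem sectional_eq (hE : IsEinsteinOnFrames R lam) (hR : HasCurvatureSymmetries R)
    (h : Orthonormal ℝ ![a, b, c, d]) :
    R a b a b = R c d c d := by
  have h0 := hE _ h 0 0
  have h1 := hE _ h 1 1
  have h2 := hE _ h 2 2
  have h3 := hE _ h 3 3
  obtain ⟨⟨aa, bb, cc, dd⟩, -⟩ := orthonormal_four_iff.1 h
  simp [Fin.sum_univ_four, hR.self_left, aa, bb, cc, dd,
    -inner_self_eq_norm_sq_to_K] at h0 h1 h2 h3
  linarith [hR.swap_swap a b a b, hR.swap_swap a c a c, hR.swap_swap a d a d,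
    hR.swap_swap b c b c, hR.swap_swap b d b d, hR.swap_swap c d c d]

/-- The vanishing of an off-diagonal Ricci component. -/
theorem mixed_eq_neg (hE : IsEinsteinOnFrames R lam) (hR : HasCurvatureSymmetries R)
    (h : Orthonormal ℝ ![a, b, c, d]) :
    R a c d c = - R a b d b := by
  have h0 := hE _ h 0 3
  have ad := (orthonormal_four_iff.1 h).2.2.2.1
  simp [Fin.sum_univ_four, hR.self_left, hR.self_right, ad] at h0
  linarith

/-- The change of a sectional curvature when the frame is rotated. -/
theorem rotate (hE : IsEinsteinOnFrames R lam) (hR : HasCurvatureSymmetries R)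
    (h : Orthonormal ℝ ![a, b, c, d]) {C S : ℝ} (hCS : C ^ 2 + S ^ 2 = 1) :
    R (C • a + S • d) (C • b + S • c) (C • a + S • d) (C • b + S • c) - R a b a b =
      (R a c a c - R a b a b + R a c d b + R a b d c) / 2 * (2 * C * S) ^ 2 +
        (R a b a c + R a b d b) * (2 * C * S) * (C ^ 2 - S ^ 2) := by
  have e1 : R a b a b = R d c d c := by
    rw [hR.swap_swap d, ← hE.sectional_eq hR h]
  have e2 : R a c a c = R d b d b := by
    rw [hR.swap_swap d, ← hE.sectional_eq hR (c := b) (d := d)]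
    simp only [orthonormal_four_iff, real_inner_comm] at h ⊢
    tauto
  have e3 := hE.mixed_eq_neg hR h
  have e4 : R d b d c = - R a b a c := by
    rw [hR.swap_swap d, hR.swap_swap a, hE.mixed_eq_neg hR (b := a) (d := c)]
    simp only [orthonormal_four_iff, real_inner_comm] at h ⊢
    tauto
  have hk : R a b a b * (C ^ 2 + S ^ 2) ^ 2 = R a b a b := by rw [hCS]; ring
  conv_lhs => rw [← hk]
  simp only [map_add, map_smul, LinearMap.add_apply, LinearMap.smul_apply, smul_eq_mul]
  rw [hR.pair a c a b, hR.pair d b a b, hR.pair d c a b, hR.pair d b a c, hR.pair d c a c,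
    hR.pair d c d b, ← e1, ← e2, e3, e4]
  ring

/-- The optimality conditions of a frame maximizing `K₀₁ - K₀₃` that come from rotations of one
chirality. -/
theorem optimality (hE : IsEinsteinOnFrames R lam) (hR : HasCurvatureSymmetries R)
    (h : Orthonormal ℝ ![a, b, c, d])
    (hmax : ∀ a' b' c' d' : V, Orthonormal ℝ ![a', b', c', d'] →
      R a' b' a' b' - R a' d' a' d' ≤ R a b a b - R a d a d) :
    (R a c a c - R a b a b + R a c d b + R a b d c ≤ 0 ∧ R a b a c + R a b d b = 0) ∧
    (R a d a d - R a c a c + R a c d b - R a d b c ≤ 0 ∧ R a d a c + R a d b d = 0) ∧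
    R a b a d + R a b c b = 0 := by
  refine ⟨?_, ?_, ?_⟩
  · have := nonpos_and_eq_zero_of_forall_circle
      (a := (R a c a c - R a b a b + R a c d b + R a b d c) / 2)
      (b := R a b a c + R a b d b) fun C S hCS => by
        have h1 := hE.rotate hR h hCS
        have h2 := hmax _ _ _ _ (orthonormal_rotate h hCS)
        have h3 : R (C • a + S • d) (C • d - S • a) (C • a + S • d) (C • d - S • a)
            = R a d a d * (C ^ 2 + S ^ 2) ^ 2 := by
          simp only [map_add, map_sub, map_smul, LinearMap.add_apply, LinearMap.smul_apply,
            LinearMap.sub_apply, smul_eq_mul, hR.self_left, hR.self_right, hR.anti d a,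
            hR.anti' _ _ d a]
          ring
        rw [hCS] at h3
        linarith
    exact ⟨by linarith [this.1], this.2⟩
  · have h' : Orthonormal ℝ ![a, d, c, b] := by
      simp only [orthonormal_four_iff, real_inner_comm] at h ⊢
      tauto
    have := nonpos_and_eq_zero_of_forall_circle
      (a := -((R a c a c - R a d a d + R a c b d + R a d b c) / 2))
      (b := -(R a d a c + R a d b d)) fun C S hCS => by
        have h1 := hE.rotate hR h' hCS
        have h2 := hmax (C • a + S • b) (C • b - S • a) (C • c - S • d) (C • d + S • c) (by
          have := orthonormal_rotate h' hCS
          simp only [orthonormal_four_iff, real_inner_comm] at this ⊢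
          tauto)
        have h3 : R (C • a + S • b) (C • b - S • a) (C • a + S • b) (C • b - S • a)
            = R a b a b * (C ^ 2 + S ^ 2) ^ 2 := by
          simp only [map_add, map_sub, map_smul, LinearMap.add_apply, LinearMap.smul_apply,
            LinearMap.sub_apply, smul_eq_mul, hR.self_left, hR.self_right, hR.anti b a,
            hR.anti' _ _ b a]
          ring
        rw [hCS] at h3
        linarith
    exact ⟨by linarith [this.1, hR.anti' a c b d], by linarith [this.2]⟩
  · have h₁ : Orthonormal ℝ ![a, b, d, c] := by
      simp only [orthonormal_four_iff, real_inner_comm] at h ⊢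
      tauto
    have h₂ : Orthonormal ℝ ![a, d, -b, c] := by
      simp only [orthonormal_four_iff, inner_neg_left, inner_neg_right, real_inner_comm,
        neg_neg, neg_eq_zero] at h ⊢
      tauto
    have hmix : R a b c b = - R a d c d := hE.mixed_eq_neg hR (a := a) (b := d) (d := c) (by
      simp only [orthonormal_four_iff, real_inner_comm] at h ⊢
      tauto)
    have := nonpos_and_eq_zero_of_forall_circle
      (a := (R a d a d - R a b a b + R a d c b + R a b c d) / 2 -
        (R a (-b) a (-b) - R a d a d + R a (-b) c d + R a d c (-b)) / 2)
      (b := R a b a d + R a b c b - (R a d a (-b) + R a d c d)) fun C S hCS => by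
        have e₁ := hE.rotate hR h₁ hCS
        have e₂ := hE.rotate hR h₂ hCS
        have h2 := hmax (C • a + S • c) (C • b + S • d) (C • c - S • a) (C • d + S • -b) (by
          have := orthonormal_rotate h₁ hCS
          rw [smul_neg, ← sub_eq_add_neg]
          simp only [orthonormal_four_iff, real_inner_comm] at this ⊢
          tauto)
        linarith
    have h3 := this.2
    rw [map_neg] at h3
    linarith [hR.pair a d a b]

/-- The conclusions on the components of the curvature tensor in a frame that maximizes
`K₀₁ - K₀₃`. -/
theorem components_of_maximal (hE : IsEinsteinOnFrames R lam) (hR : HasCurvatureSymmetries R)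
    (h : Orthonormal ℝ ![a, b, c, d])
    (hmax : ∀ a' b' c' d' : V, Orthonormal ℝ ![a', b', c', d'] →
      R a' b' a' b' - R a' d' a' d' ≤ R a b a b - R a d a d) :
    (∀ i j k : Fin 4, j ≠ k →
      R (![a, b, c, d] i) (![a, b, c, d] j) (![a, b, c, d] i) (![a, b, c, d] k) = 0) ∧
    |R a b c d - R a c d b| ≤ R a b a b - R a c a c ∧
    |R a c d b - R a d b c| ≤ R a c a c - R a d a d := by
  obtain ⟨⟨p1, p2⟩, ⟨p3, p4⟩, p5⟩ := hE.optimality hR h hmax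
  obtain ⟨⟨q1, q2⟩, ⟨q3, q4⟩, q5⟩ := hE.optimality hR (a := a) (b := b) (c := c) (d := -d)
    (by simpa only [orthonormal_four_iff, inner_neg_left, inner_neg_right, neg_neg,
      neg_eq_zero] using h) (by simpa using hmax)
  simp only [map_neg, LinearMap.neg_apply, neg_neg] at q1 q2 q3 q4 q5
  have hs := hR.anti' a b d c
  refine ⟨?_, abs_le.2 ⟨by linarith, by linarith⟩, abs_le.2 ⟨by linarith, by linarith⟩⟩
  obtain ⟨-, ab, ac, ad, bc, bd, cd⟩ := orthonormal_four_iff.1 h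
  have ric01 := hE _ h 0 1
  have ric02 := hE _ h 0 2
  have ric03 := hE _ h 0 3
  have ric12 := hE _ h 1 2
  have ric13 := hE _ h 1 3
  have ric23 := hE _ h 2 3
  simp [Fin.sum_univ_four, hR.self_left, hR.self_right, ab, ac, ad, bc, bd, cd]
    at ric01 ric02 ric03 ric12 ric13 ric23
  have sw := hR.swap_swap
  have abac : R a b a c = 0 := by linarith
  have abad : R a b a d = 0 := by linarith
  have acad : R a c a d = 0 := by linarith [hR.pair a c a d]
  have babc : R b a b c = 0 := by linarith [sw b a b c]
  have babd : R b a b d = 0 := by linarith [sw b a b d]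
  have bcbd : R b c b d = 0 := by linarith [sw c a d a, sw c b d b]
  have dadb : R d a d b = 0 := by linarith [sw d a d b]
  have dadc : R d a d c = 0 := by linarith [sw d a d c, sw b a b c]
  have dbdc : R d b d c = 0 := by linarith [sw d b d c, sw b a c a]
  have cacb : R c a c b = 0 := by linarith [sw c a c b, sw d a d b]
  have cacd : R c a c d = 0 := by linarith [sw c a c d, sw b a b d]
  have cbcd : R c b c d = 0 := by linarith [sw c b c d, sw b a d a]
  have key : ∀ i j k : Fin 4, j < k →
      R (![a, b, c, d] i) (![a, b, c, d] j) (![a, b, c, d] i) (![a, b, c, d] k) = 0 := by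
    simp [Fin.forall_fin_succ, hR.self_left, hR.self_right, abac, abad, acad, babc, babd, bcbd,
      cacb, cacd, cbcd, dadb, dadc, dbdc]
  intro i j k hjk
  rcases lt_or_gt_of_ne hjk with hlt | hlt
  · exact key i j k hlt
  · rw [hR.pair]
    exact key i k j hlt

end IsEinsteinOnFrames

/-- Bounds for a quadratic form that is diagonal in the coordinates `xᵢ ± yᵢ`, on the product of
two spheres. -/
theorem sectional_bounds_aux {x1 x2 x3 y1 y2 y3 k1 k2 k3 r1 r2 r3 K : ℝ}
    (hplucker : x1 * y1 + x2 * y2 + x3 * y3 = 0)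
    (hnorm : x1 ^ 2 + y1 ^ 2 + x2 ^ 2 + y2 ^ 2 + x3 ^ 2 + y3 ^ 2 = 1)
    (h12 : |r1 - r2| ≤ k1 - k2) (h23 : |r2 - r3| ≤ k2 - k3)
    (hK : K = k1 * (x1 ^ 2 + y1 ^ 2) + k2 * (x2 ^ 2 + y2 ^ 2) + k3 * (x3 ^ 2 + y3 ^ 2) +
      2 * (r1 * (x1 * y1) + r2 * (x2 * y2) + r3 * (x3 * y3))) :
    K ≤ k1 ∧ k3 ≤ K := by
  obtain ⟨a12, b12⟩ := abs_le.1 h12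
  obtain ⟨a23, b23⟩ := abs_le.1 h23
  have hp : (x1 + y1) ^ 2 + (x2 + y2) ^ 2 + (x3 + y3) ^ 2 = 1 := by
    linear_combination hnorm + 2 * hplucker
  have hm : (x1 - y1) ^ 2 + (x2 - y2) ^ 2 + (x3 - y3) ^ 2 = 1 := by
    linear_combination hnorm - 2 * hplucker
  have hK' : 2 * K = (k1 + r1) * (x1 + y1) ^ 2 + (k2 + r2) * (x2 + y2) ^ 2 +
      (k3 + r3) * (x3 + y3) ^ 2 + (k1 - r1) * (x1 - y1) ^ 2 + (k2 - r2) * (x2 - y2) ^ 2 +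
      (k3 - r3) * (x3 - y3) ^ 2 := by
    rw [hK]; ring
  have bound {s t : ℝ} (q : ℝ) (hst : s ≤ t) : s * q ^ 2 ≤ t * q ^ 2 :=
    mul_le_mul_of_nonneg_right hst (sq_nonneg q)
  constructor
  · have e1 := bound (s := k2 + r2) (t := k1 + r1) (x2 + y2) (by linarith)
    have e2 := bound (s := k3 + r3) (t := k1 + r1) (x3 + y3) (by linarith)
    have e3 := bound (s := k2 - r2) (t := k1 - r1) (x2 - y2) (by linarith)
    have e4 := bound (s := k3 - r3) (t := k1 - r1) (x3 - y3) (by linarith)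
    linear_combination (hK' + e1 + e2 + e3 + e4 + (k1 + r1) * hp + (k1 - r1) * hm) / 2
  · have e1 := bound (s := k3 + r3) (t := k1 + r1) (x1 + y1) (by linarith)
    have e2 := bound (s := k3 + r3) (t := k2 + r2) (x2 + y2) (by linarith)
    have e3 := bound (s := k3 - r3) (t := k1 - r1) (x1 - y1) (by linarith)
    have e4 := bound (s := k3 - r3) (t := k2 - r2) (x2 - y2) (by linarith)
    linear_combination (-hK' + e1 + e2 + e3 + e4 - (k3 + r3) * hp - (k3 - r3) * hm) / 2

/-- In a frame satisfying the last two conclusions of Berger's lemma, the sectional curvatures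
`K₀₁` and `K₀₃` are extremal. -/
theorem sectional_bounds (hR : HasCurvatureSymmetries R) (hE : IsEinsteinOnFrames R lam)
    (e : OrthonormalBasis (Fin 4) ℝ V)
    (hmix : ∀ i j k : Fin 4, j ≠ k → R (e i) (e j) (e i) (e k) = 0)
    (h12 : |R (e 0) (e 1) (e 2) (e 3) - R (e 0) (e 2) (e 3) (e 1)| ≤
      R (e 0) (e 1) (e 0) (e 1) - R (e 0) (e 2) (e 0) (e 2))
    (h23 : |R (e 0) (e 2) (e 3) (e 1) - R (e 0) (e 3) (e 1) (e 2)| ≤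
      R (e 0) (e 2) (e 0) (e 2) - R (e 0) (e 3) (e 0) (e 3))
    {u v : V} (hu : ⟪u, u⟫ = 1) (hv : ⟪v, v⟫ = 1) (huv : ⟪u, v⟫ = 0) :
    R u v u v ≤ R (e 0) (e 1) (e 0) (e 1) ∧ R (e 0) (e 3) (e 0) (e 3) ≤ R u v u v := by
  have hframe : Orthonormal ℝ ![e 0, e 1, e 2, e 3] := by
    convert e.orthonormal using 1
    ext i
    fin_cases i <;> rfl
  have k1 := hE.sectional_eq hR hframe
  have k2 : R (e 0) (e 2) (e 0) (e 2) = R (e 3) (e 1) (e 3) (e 1) := by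
    rw [hR.swap_swap (e 3), ← hE.sectional_eq hR (c := e 1) (d := e 3)]
    simp only [orthonormal_four_iff, real_inner_comm] at hframe ⊢
    tauto
  have k3 : R (e 0) (e 3) (e 0) (e 3) = R (e 1) (e 2) (e 1) (e 2) := by
    rw [← hE.sectional_eq hR]
    simp only [orthonormal_four_iff, real_inner_comm] at hframe ⊢
    tauto
  have hplane (x y : V) : R u v x y =
      (⟪e 0, u⟫ * ⟪e 1, v⟫ - ⟪e 1, u⟫ * ⟪e 0, v⟫) * R (e 0) (e 1) x y +
      (⟪e 0, u⟫ * ⟪e 2, v⟫ - ⟪e 2, u⟫ * ⟪e 0, v⟫) * R (e 0) (e 2) x y +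
      (⟪e 0, u⟫ * ⟪e 3, v⟫ - ⟪e 3, u⟫ * ⟪e 0, v⟫) * R (e 0) (e 3) x y +
      (⟪e 2, u⟫ * ⟪e 3, v⟫ - ⟪e 3, u⟫ * ⟪e 2, v⟫) * R (e 2) (e 3) x y +
      (⟪e 3, u⟫ * ⟪e 1, v⟫ - ⟪e 1, u⟫ * ⟪e 3, v⟫) * R (e 3) (e 1) x y +
      (⟪e 1, u⟫ * ⟪e 2, v⟫ - ⟪e 2, u⟫ * ⟪e 1, v⟫) * R (e 1) (e 2) x y := by
    conv_lhs => rw [← e.sum_repr' u, ← e.sum_repr' v]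
    simp only [Fin.sum_univ_four, map_add, map_smul, LinearMap.add_apply, LinearMap.smul_apply,
      smul_eq_mul, hR.self_left, hR.anti (e 1) (e 0), hR.anti (e 2) (e 0), hR.anti (e 3) (e 0),
      hR.anti (e 3) (e 2), hR.anti (e 1) (e 3), hR.anti (e 2) (e 1)]
    ring
  have inner_eq (x y : V) : ⟪x, y⟫ = ⟪e 0, x⟫ * ⟪e 0, y⟫ + ⟪e 1, x⟫ * ⟪e 1, y⟫ +
      ⟪e 2, x⟫ * ⟪e 2, y⟫ + ⟪e 3, x⟫ * ⟪e 3, y⟫ := by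
    rw [← e.sum_inner_mul_inner x y, Fin.sum_univ_four]
    simp only [real_inner_comm]
  rw [inner_eq] at hu hv huv
  have hK := hplane u v
  have z1 (i j k : Fin 4) (h : j ≠ k) : R (e j) (e i) (e k) (e i) = 0 := by
    rw [hR.swap_swap, hmix i j k h]
  have z2 (i j k : Fin 4) (h : j ≠ k) : R (e i) (e j) (e k) (e i) = 0 := by
    rw [hR.anti', hmix i j k h, neg_zero]
  have z3 (i j k : Fin 4) (h : j ≠ k) : R (e j) (e i) (e i) (e k) = 0 := by
    rw [hR.anti, hmix i j k h, neg_zero]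
  rw [hR.pair (e 0) (e 1) u v, hR.pair (e 0) (e 2) u v, hR.pair (e 0) (e 3) u v,
    hR.pair (e 2) (e 3) u v, hR.pair (e 3) (e 1) u v, hR.pair (e 1) (e 2) u v,
    hplane (e 0) (e 1), hplane (e 0) (e 2), hplane (e 0) (e 3), hplane (e 2) (e 3),
    hplane (e 3) (e 1), hplane (e 1) (e 2)] at hK
  simp [hmix, z1, z2, z3, hR.pair (e 2) (e 3) (e 0) (e 1), hR.pair (e 3) (e 1) (e 0) (e 2),
    hR.pair (e 1) (e 2) (e 0) (e 3), ← k1, ← k2, ← k3] at hK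
  generalize ⟪e 0, u⟫ = u0 at *
  generalize ⟪e 1, u⟫ = u1 at *
  generalize ⟪e 2, u⟫ = u2 at *
  generalize ⟪e 3, u⟫ = u3 at *
  generalize ⟪e 0, v⟫ = v0 at *
  generalize ⟪e 1, v⟫ = v1 at *
  generalize ⟪e 2, v⟫ = v2 at *
  generalize ⟪e 3, v⟫ = v3 at *
  have hplucker : (u0 * v1 - u1 * v0) * (u2 * v3 - u3 * v2) +
      (u0 * v2 - u2 * v0) * (u3 * v1 - u1 * v3) +
      (u0 * v3 - u3 * v0) * (u1 * v2 - u2 * v1) = 0 := by ring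
  have hnorm : (u0 * v1 - u1 * v0) ^ 2 + (u2 * v3 - u3 * v2) ^ 2 + (u0 * v2 - u2 * v0) ^ 2 +
      (u3 * v1 - u1 * v3) ^ 2 + (u0 * v3 - u3 * v0) ^ 2 + (u1 * v2 - u2 * v1) ^ 2 = 1 := by
    linear_combination (v0 * v0 + v1 * v1 + v2 * v2 + v3 * v3) * hu + hv -
      (u0 * v0 + u1 * v1 + u2 * v2 + u3 * v3) * huv
  generalize u0 * v1 - u1 * v0 = x1 at *
  generalize u2 * v3 - u3 * v2 = y1 at *
  generalize u0 * v2 - u2 * v0 = x2 at *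
  generalize u3 * v1 - u1 * v3 = y2 at *
  generalize u0 * v3 - u3 * v0 = x3 at *
  generalize u1 * v2 - u2 * v1 = y3 at *
  exact sectional_bounds_aux hplucker hnorm h12 h23 (by rw [hK]; ring)

/-- The functional `K₀₁ - K₀₃` attains its maximum over orthonormal frames. -/
theorem exists_maximal_frame [FiniteDimensional ℝ V] (hdim : Module.finrank ℝ V = 4)
    (R : V →ₗ[ℝ] V →ₗ[ℝ] V →ₗ[ℝ] V →ₗ[ℝ] ℝ) :
    ∃ f : Fin 4 → V, Orthonormal ℝ f ∧ ∀ g : Fin 4 → V, Orthonormal ℝ g →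
      R (g 0) (g 1) (g 0) (g 1) - R (g 0) (g 3) (g 0) (g 3) ≤
        R (f 0) (f 1) (f 0) (f 1) - R (f 0) (f 3) (f 0) (f 3) := by
  let b : OrthonormalBasis (Fin 4) ℝ V := (stdOrthonormalBasis ℝ V).reindex (finCongr hdim)
  have hexp (x y z w : V) : R x y z w = ∑ l, ∑ k, ∑ j, ∑ i,
      ⟪b l, w⟫ * (⟪b k, z⟫ * (⟪b j, y⟫ * (⟪b i, x⟫ * R (b i) (b j) (b k) (b l)))) := by
    conv_lhs => rw [← b.sum_repr' x, ← b.sum_repr' y, ← b.sum_repr' z, ← b.sum_repr' w]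
    simp only [map_sum, map_smul, LinearMap.sum_apply, LinearMap.smul_apply, smul_eq_mul,
      Finset.mul_sum]
  have hcont (i j : Fin 4) : Continuous fun f : Fin 4 → V => R (f i) (f j) (f i) (f j) :=
    Continuous.congr (by fun_prop) fun f => (hexp (f i) (f j) (f i) (f j)).symm
  have hclosed : IsClosed {f : Fin 4 → V | Orthonormal ℝ f} := by
    simp only [orthonormal_iff_ite, Set.ofPred_forall]
    exact isClosed_iInter fun i => isClosed_iInter fun j =>
      isClosed_eq (by fun_prop) continuous_const
  have hcompact : IsCompact {f : Fin 4 → V | Orthonormal ℝ f} := by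
    refine (isCompact_univ_pi fun _ : Fin 4 => isCompact_closedBall (0 : V) 1).of_isClosed_subset
      hclosed fun f hf i _ => ?_
    simp [hf.1 i]
  obtain ⟨f, hf, hmax⟩ := hcompact.exists_isMaxOn ⟨b, b.orthonormal⟩
    (f := fun f : Fin 4 → V => R (f 0) (f 1) (f 0) (f 1) - R (f 0) (f 3) (f 0) (f 3))
    ((hcont 0 1).sub (hcont 0 3)).continuousOn
  exact ⟨f, hf, fun g hg => hmax hg⟩

end BergerAux

/-- **Berger's lemma** (algebraic form) for Einstein algebraic curvature tensors
on a 4-dimensional real inner product space. -/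
theorem berger_lemma
    {V : Type*} [NormedAddCommGroup V] [InnerProductSpace ℝ V]
    [FiniteDimensional ℝ V] (hdim : Module.finrank ℝ V = 4)
    (R : V →ₗ[ℝ] V →ₗ[ℝ] V →ₗ[ℝ] V →ₗ[ℝ] ℝ) (lam : ℝ)
    (hanti : ∀ x y z w : V, R x y z w = - R y x z w)
    (hpair : ∀ x y z w : V, R x y z w = R z w x y)
    (hbianchi : ∀ x y z w : V, R x y z w + R y z x w + R z x y w = 0)
    (heinstein : ∀ (e : OrthonormalBasis (Fin 4) ℝ V) (x y : V),
      ∑ i, R x (e i) y (e i) = lam * ⟪x, y⟫) :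
    ∃ e : OrthonormalBasis (Fin 4) ℝ V,
      -- (1) K₀₁ is the maximum of sectional curvature over all 2-planes
      (∀ u v : V, ⟪u, u⟫ = 1 → ⟪v, v⟫ = 1 → ⟪u, v⟫ = 0 →
        R u v u v ≤ R (e 0) (e 1) (e 0) (e 1)) ∧
      -- (2) K₀₃ is the minimum of sectional curvature over all 2-planes
      (∀ u v : V, ⟪u, u⟫ = 1 → ⟪v, v⟫ = 1 → ⟪u, v⟫ = 0 →
        R (e 0) (e 3) (e 0) (e 3) ≤ R u v u v) ∧
      -- (3) R_{ijik} = 0 for j ≠ k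
      (∀ i j k : Fin 4, j ≠ k → R (e i) (e j) (e i) (e k) = 0) ∧
      -- (4) the two inequalities on the off-diagonal terms
      |R (e 0) (e 1) (e 2) (e 3) - R (e 0) (e 2) (e 3) (e 1)| ≤
        R (e 0) (e 1) (e 0) (e 1) - R (e 0) (e 2) (e 0) (e 2) ∧
      |R (e 0) (e 2) (e 3) (e 1) - R (e 0) (e 3) (e 1) (e 2)| ≤
        R (e 0) (e 2) (e 0) (e 2) - R (e 0) (e 3) (e 0) (e 3) := by
  have hR : HasCurvatureSymmetries R := ⟨hanti, hpair⟩
  have hbasis (f : Fin 4 → V) (hf : Orthonormal ℝ f) :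
      ∃ e : OrthonormalBasis (Fin 4) ℝ V, ⇑e = f := by
    obtain ⟨e, he⟩ := Orthonormal.exists_orthonormalBasis_extension_of_card_eq
      (s := Set.univ) (v := f) (by simpa using hdim) (hf.comp _ Subtype.val_injective)
    exact ⟨e, funext fun i => he i trivial⟩
  have hE : IsEinsteinOnFrames R lam := fun f hf i j => by
    obtain ⟨e, rfl⟩ := hbasis f hf
    exact heinstein e _ _
  obtain ⟨f, hf, hmax⟩ := exists_maximal_frame hdim R
  obtain ⟨e, rfl⟩ := hbasis f hf
  have he : ![e 0, e 1, e 2, e 3] = e := by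
    ext i
    fin_cases i <;> rfl
  obtain ⟨h3, h4, h5⟩ := hE.components_of_maximal hR (he ▸ hf) fun _ _ _ _ h => hmax _ h
  rw [he] at h3
  exact ⟨e, fun u v hu hv huv => (sectional_bounds hR hE e h3 h4 h5 hu hv huv).1,
    fun u v hu hv huv => (sectional_bounds hR hE e h3 h4 h5 hu hv huv).2, h3, h4, h5⟩
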